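/- Let β > 0 and define H : (0,∞)² → ℝ by H(a, p) = (1/(15π))·(8·(a − p)^{5/2} + 15·(−(3/8)·p·(a − 2p)·√(a − p) + √p·((3/8)·a² − a·p + p²)·arcsin √(p/a))) if a > p and H(a, p) = (1/2)·√p·((3/8)·a² − a·p + p²) if a ≤ p. Then ∫₀^∞ ∫₀^∞ (β^{3/2}/√(π·p))·e^{−β(a + p)}·H(a, p) da dp = 2/(β²·√(2πβ)). -/

import Mathlib

open MeasureTheory Real

noncomputable def gPoly (t : ℝ) : ℝ := (3/8)*t^2 - t + 1

noncomputable def gOne (t : ℝ) : ℝ :=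
  (1/(15*π)) * (8 * (√(t-1))^5 + 15 * (-((3/8) * (t - 2) * √(t - 1))
    + gPoly t * (π/2 - arctan (√(t-1)))))

noncomputable def gG (t : ℝ) : ℝ := if 1 < t then gOne t else (1/2) * gPoly t

noncomputable def rR (t : ℝ) : ℝ :=
  7/24 - 3/8/(1+t) + 7/8/(1+t)^2 - 19/24/(1+t)^3

noncomputable def phiS (s : ℝ) : ℝ :=
  (1/(15*π)) * (15 * rR (1+s^2) * (π/2 - arctan s)
    + (-391/24 * s/(2+s^2)^3 + 67/3 * s/(2+s^2)^2 - 83/8*s/(2+s^2))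
    + 5*√2*arctan (s/√2))

lemma gPoly_pos (t : ℝ) : 0 < gPoly t := by
  unfold gPoly; nlinarith [sq_nonneg (3*t-4)]

lemma gG_nonneg (t : ℝ) : 0 ≤ gG t := by
  unfold gG
  split_ifs with h
  · unfold gOne
    have hp := gPoly_pos t
    have ha : 0 ≤ π/2 - arctan (√(t-1)) := by linarith [arctan_lt_pi_div_two (√(t-1))]
    have hs : 0 ≤ √(t-1) := sqrt_nonneg _
    have hq : (√(t-1))^2 = t - 1 := sq_sqrt (by linarith)
    have ht : t - 2 = (√(t-1))^2 - 1 := by linarith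
    have : 0 ≤ 8 * (√(t-1))^5 + 15 * (-((3/8) * (t - 2) * √(t - 1))) := by
      rw [ht]
      generalize √(t-1) = s at hs
      have : 8 * s^5 + 15 * (-((3/8) * (s^2 - 1) * s)) = s * (8 * (s^2-45/128)^2 + (45/8 - 8*(45/128)^2)) := by
        ring
      rw [this]
      have : (0:ℝ) ≤ (45/8 - 8*(45/128)^2) := by norm_num
      positivity
    have h2 := mul_nonneg hp.le ha
    apply mul_nonneg (by positivity)
    linarith
  · have := gPoly_pos t
    positivity

lemma hasDerivAt_rR (t : ℝ) (ht : 1 + t ≠ 0) : HasDerivAt rR (gPoly t / (1+t)^4) t := by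
  unfold rR gPoly
  have h1 : HasDerivAt (fun t : ℝ => 1 + t) 1 t := (hasDerivAt_id t).const_add 1
  have a1 := (hasDerivAt_const t (3/8:ℝ)).div h1 ht
  have a2 := (hasDerivAt_const t (7/8:ℝ)).div (h1.pow 2) (pow_ne_zero 2 ht)
  have a3 := (hasDerivAt_const t (19/24:ℝ)).div (h1.pow 3) (pow_ne_zero 3 ht)
  convert! (((hasDerivAt_const t (7/24:ℝ)).sub a1).add a2).sub a3 using 1
  simp only [Pi.pow_apply]
  field_simp
  push_cast
  ring

lemma hasDerivAt_phiS (s : ℝ) (hs : 0 < s) :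
    HasDerivAt phiS (2*s*((1/(15*π)) * (8 * s^5 + 15 * (-((3/8) * (s^2-1) * s)
    + gPoly (1+s^2) * (π/2 - arctan s))) / (2+s^2)^4)) s := by
  have hu : (2 + s^2) ≠ 0 := by positivity
  have h1 : HasDerivAt (fun s : ℝ => 1 + s^2) (2*s) s := by
    convert! ((hasDerivAt_pow 2 s).const_add 1) using 1; simp
  have h2 : HasDerivAt (fun s : ℝ => 2 + s^2) (2*s) s := by
    convert! ((hasDerivAt_pow 2 s).const_add 2) using 1; simp
  have hR := (hasDerivAt_rR (1+s^2) (by positivity)).comp s h1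
  have ha := (hasDerivAt_arctan s).const_sub (π/2)
  have l (c : ℝ) : HasDerivAt (fun s : ℝ => c * s) c s := by
    simpa using (hasDerivAt_id s).const_mul c
  have a1 := (l (-391/24)).div (h2.pow 3) (pow_ne_zero 3 hu)
  have a2 := (l (67/3)).div (h2.pow 2) (pow_ne_zero 2 hu)
  have a3 := (l (83/8)).div h2 hu
  have b := (((hasDerivAt_id s).div_const (√2)).arctan).const_mul (5*√2)
  have key := ((((hR.const_mul 15).mul ha).add ((a1.add a2).sub a3)).add b).const_mul (1/(15*π))
  unfold phiS
  convert! key using 1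
  have e : 1 + (1 + s^2) = 2 + s^2 := by ring
  have q2 : (√2)^2 = 2 := sq_sqrt (by norm_num)
  have e2 : 5 * √2 * (1 / (1 + (s/√2)^2) * (1/√2)) = 10 / (2+s^2) := by
    rw [div_pow, q2]; field_simp; norm_num
  simp only [Pi.pow_apply, Function.comp, id]
  rw [e2]
  have e3 : rR (1+s^2) = (1+s^2) * (7*(2+s^2)^2 - 2*(2+s^2)+19)/(24*(2+s^2)^3) := by
    unfold rR; rw [e]; field_simp; ring
  rw [e3, e]
  generalize π/2 - arctan s = A
  generalize gPoly (1+s^2) = P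
  have hpi := pi_ne_zero
  field_simp
  push_cast
  ring

lemma phi_cont : Continuous phiS := by
  unfold phiS rR
  have h : ∀ s : ℝ, 1 + (1 + s^2) ≠ 0 := fun s => by positivity
  have h' : ∀ s : ℝ, 2 + s^2 ≠ 0 := fun s => by positivity
  have h2 : ∀ s : ℝ, (1 + (1 + s^2))^2 ≠ 0 := fun s => by positivity
  have h3 : ∀ s : ℝ, (1 + (1 + s^2))^3 ≠ 0 := fun s => by positivity
  have h2' : ∀ s : ℝ, (2 + s^2)^2 ≠ 0 := fun s => by positivity
  have h3' : ∀ s : ℝ, (2 + s^2)^3 ≠ 0 := fun s => by positivity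
  fun_prop (disch := assumption)

lemma phi_lim : Filter.Tendsto phiS Filter.atTop (nhds (√2/6)) := by
  have hs2 : Filter.Tendsto (fun s : ℝ => 2 + s^2) Filter.atTop Filter.atTop :=
    Filter.tendsto_atTop_add_const_left _ _ (Filter.tendsto_pow_atTop (by norm_num))
  have hi : Filter.Tendsto (fun s : ℝ => (2 + s^2)⁻¹) Filter.atTop (nhds 0) :=
    tendsto_inv_atTop_zero.comp hs2
  have hat : Filter.Tendsto arctan Filter.atTop (nhds (π/2)) :=
    tendsto_nhds_of_tendsto_nhdsWithin tendsto_arctan_atTop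
  have hat2 : Filter.Tendsto (fun s : ℝ => arctan (s/√2)) Filter.atTop (nhds (π/2)) :=
    hat.comp (Filter.tendsto_id.atTop_div_const (by positivity))
  have hsi : Filter.Tendsto (fun s : ℝ => s * (2 + s^2)⁻¹) Filter.atTop (nhds 0) := by
    refine squeeze_zero' (g := fun s : ℝ => s⁻¹) ?_ ?_ tendsto_inv_atTop_zero
    · filter_upwards [Filter.eventually_gt_atTop 0] with s hs
      positivity
    · filter_upwards [Filter.eventually_gt_atTop 0] with s hs
      field_simp
      linarith
  have key := ((((((((hi.const_mul (3/8)).const_sub (7/24)).add ((hi.pow 2).const_mul (7/8))).sub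
    ((hi.pow 3).const_mul (19/24))).const_mul 15).mul (hat.const_sub (π/2))).add
    ((((hsi.mul (hi.pow 2)).const_mul (-391/24)).add ((hsi.mul hi).const_mul (67/3))).sub
      (hsi.const_mul (83/8)))).add (hat2.const_mul (5*√2))).const_mul (1/(15*π))
  have hpi := pi_ne_zero
  convert! key using 1
  · funext s
    have e : 1 + (1 + s^2) = 2 + s^2 := by ring
    have hu : (2 + s^2) ≠ 0 := by positivity
    unfold phiS rR
    rw [e]
    congr 2
    field_simp
  · congr 1
    field_simp
    ring

lemma hasDerivAt_phit (t : ℝ) (ht : 1 < t) :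
    HasDerivAt (fun t => phiS (√(t-1))) (gG t / (1+t)^4) t := by
  have hs : 0 < √(t-1) := sqrt_pos.2 (by linarith)
  have hq : (√(t-1))^2 = t - 1 := sq_sqrt (by linarith)
  have hd : HasDerivAt (fun t : ℝ => √(t-1)) (1/(2*√(t-1))) t :=
    ((hasDerivAt_id t).sub_const 1).sqrt (by simp; linarith)
  have := (hasDerivAt_phiS _ hs).comp t hd
  convert! this using 1
  unfold gG
  rw [if_pos ht]
  unfold gOne
  rw [hq, show 1 + (t-1) = t by ring, show 2 + (t-1) = 1 + t by ring, show t - 1 - 1 = t - 2 by ring]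
  generalize π/2 - arctan _ = A
  have : 1 + t ≠ 0 := by positivity
  field_simp

lemma int_Ioi : IntegrableOn (fun t => gG t / (1+t)^4) (Set.Ioi 1) ∧
    ∫ t in Set.Ioi 1, gG t / (1+t)^4 = √2/6 - (1/2) * rR 1 := by
  have hc : ContinuousWithinAt (fun t => phiS (√(t-1))) (Set.Ici 1) 1 := by
    apply Continuous.continuousWithinAt
    exact phi_cont.comp (by fun_prop)
  have hl : Filter.Tendsto (fun t => phiS (√(t-1))) Filter.atTop (nhds (√2/6)) :=
    phi_lim.comp (tendsto_sqrt_atTop.comp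
      (Filter.tendsto_atTop_add_const_right _ (-1) Filter.tendsto_id))
  have hn : ∀ t ∈ Set.Ioi (1:ℝ), 0 ≤ gG t / (1+t)^4 := fun t ht =>
    div_nonneg (gG_nonneg t) (by have := Set.mem_Ioi.1 ht; positivity)
  refine ⟨integrableOn_Ioi_deriv_of_nonneg hc hasDerivAt_phit hn hl, ?_⟩
  rw [integral_Ioi_of_hasDerivAt_of_nonneg hc hasDerivAt_phit hn hl]
  congr 1
  have := pi_ne_zero
  simp [phiS]
  field_simp

lemma int_Ioc : IntegrableOn (fun t => gG t / (1+t)^4) (Set.Ioc 0 1) ∧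
    ∫ t in Set.Ioc 0 1, gG t / (1+t)^4 = (1/2) * rR 1 := by
  have he : Set.EqOn (fun t => (1/2) * (gPoly t / (1+t)^4)) (fun t => gG t / (1+t)^4) (Set.Ioc 0 1) := by
    intro t ht
    simp only [gG, if_neg (not_lt.2 ht.2)]
    ring
  have hci : IntervalIntegrable (fun t => (1/2) * (gPoly t / (1+t)^4)) volume 0 1 := by
    apply ContinuousOn.intervalIntegrable
    intro t ht
    rw [Set.uIcc_of_le zero_le_one] at ht
    have : (1+t)^4 ≠ 0 := by have := ht.1; positivity
    apply ContinuousAt.continuousWithinAt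
    unfold gPoly
    fun_prop (disch := assumption)
  constructor
  · exact ((intervalIntegrable_iff_integrableOn_Ioc_of_le zero_le_one).1 hci).congr_fun he measurableSet_Ioc
  · rw [← setIntegral_congr_fun measurableSet_Ioc he, ← intervalIntegral.integral_of_le zero_le_one,
      intervalIntegral.integral_eq_sub_of_hasDerivAt (f := fun t => (1/2) * rR t) ?_ hci]
    · norm_num [rR]
    · intro t ht
      rw [Set.uIcc_of_le zero_le_one] at ht
      exact (hasDerivAt_rR t (by have := ht.1; positivity)).const_mul _

lemma int_all : IntegrableOn (fun t => gG t / (1+t)^4) (Set.Ioi 0) ∧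
    ∫ t in Set.Ioi 0, gG t / (1+t)^4 = √2/6 := by
  rw [← Set.Ioc_union_Ioi_eq_Ioi (zero_le_one (α := ℝ))]
  refine ⟨int_Ioc.1.union int_Ioi.1, ?_⟩
  rw [setIntegral_union (Set.Ioc_disjoint_Ioi le_rfl) measurableSet_Ioi int_Ioc.1 int_Ioi.1,
    int_Ioc.2, int_Ioi.2]
  ring

lemma gamma_int (b : ℝ) (hb : 0 < b) :
    ∫ p in Set.Ioi (0:ℝ), p^3 * exp (-b*p) = 6/b^4 := by
  have := Real.integral_rpow_mul_exp_neg_mul_Ioi (a := 4) (r := b) (by norm_num) hb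
  have h3 : (4:ℝ) - 1 = (3:ℕ) := by norm_num
  have hG : Real.Gamma 4 = 6 := by
    rw [show (4:ℝ) = ((3:ℕ):ℝ) + 1 by norm_num, Real.Gamma_nat_eq_factorial 3]
    norm_num [Nat.factorial]
  rw [h3, hG, show (4:ℝ) = (4:ℕ) by norm_num] at this
  simp only [rpow_natCast] at this
  simp only [neg_mul]
  rw [this]
  field_simp

lemma gamma_intble (b : ℝ) (hb : 0 < b) :
    IntegrableOn (fun p => p^3 * exp (-b*p)) (Set.Ioi (0:ℝ)) := by
  apply Integrable.of_integral_ne_zero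
  rw [gamma_int b hb]
  positivity

lemma gG_meas : Measurable gG := by
  unfold gG
  refine Measurable.ite measurableSet_Ioi ?_ ?_
  · unfold gOne gPoly; fun_prop
  · unfold gPoly; fun_prop

lemma arcsin_eq (t : ℝ) (ht : 1 < t) : arcsin (√(1/t)) = π/2 - arctan (√(t-1)) := by
  rw [arctan_eq_arccos (sqrt_nonneg _), arccos, sq_sqrt (by linarith), ← sqrt_inv]
  simp

lemma scale (β p t : ℝ) (hp : 0 < p) :
    p * ((β ^ ((3:ℝ)/2) / Real.sqrt (Real.pi * p)) * Real.exp (-β*(p * t + p)) *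
          (if p < p * t then
              (1/(15*Real.pi)) * (8 * (p * t - p) ^ ((5:ℝ)/2)
                + 15 * (-((3/8) * p * (p * t - 2*p) * Real.sqrt (p * t - p))
                    + Real.sqrt p * ((3/8)*(p * t)^2 - (p * t)*p + p^2)
                        * Real.arcsin (Real.sqrt (p/(p * t)))))
            else (1/2) * Real.sqrt p * ((3/8)*(p * t)^2 - (p * t)*p + p^2))) =
    (β ^ ((3:ℝ)/2) / √π * gG t) * (p^3 * exp (-(β * (1+t)) * p)) := by
  have hiff : p < p * t ↔ 1 < t := by
    constructor
    · intro h; by_contra hh; nlinarith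
    · intro h; nlinarith
  have he : -β*(p * t + p) = -(β * (1+t)) * p := by ring
  have hsp : 0 < √p := sqrt_pos.2 hp
  have hspi : 0 < √π := sqrt_pos.2 pi_pos
  rw [he, sqrt_mul pi_pos.le]
  unfold gG
  simp only [hiff]
  split_ifs with h
  · have h5 : (p*t - p) ^ ((5:ℝ)/2) = p^2 * √p * (√(t-1))^5 := by
      rw [show p*t - p = p * (t-1) by ring, mul_rpow hp.le (by linarith)]
      have : ∀ x : ℝ, 0 ≤ x → x ^ ((5:ℝ)/2) = (√x)^5 := fun x hx => by
        rw [sqrt_eq_rpow, ← rpow_natCast, ← rpow_mul hx]; norm_num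
      rw [this p hp.le, this (t-1) (by linarith)]
      rw [show (√p)^5 = ((√p)^2)^2 * √p by ring, sq_sqrt hp.le]
    have hs : √(p*t-p) = √p * √(t-1) := by
      rw [show p*t - p = p * (t-1) by ring, sqrt_mul hp.le]
    have hd : p/(p*t) = 1/t := by
      have : t ≠ 0 := by positivity
      field_simp
    rw [h5, hs, hd, arcsin_eq t h]
    unfold gOne gPoly
    have hpi := pi_ne_zero
    generalize exp _ = E
    generalize π/2 - arctan _ = A
    generalize β ^ ((3:ℝ)/2) = B
    field_simp
  · unfold gPoly
    generalize exp _ = E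
    generalize β ^ ((3:ℝ)/2) = B
    field_simp

lemma swap_intble (β : ℝ) (hβ : 0 < β) (C : ℝ) :
    Integrable (Function.uncurry fun p t : ℝ => (C * gG t) * (p^3 * exp (-(β * (1+t)) * p)))
      ((volume.restrict (Set.Ioi 0)).prod (volume.restrict (Set.Ioi 0))) := by
  have hm : Measurable (Function.uncurry fun p t : ℝ => (C * gG t) * (p^3 * exp (-(β * (1+t)) * p))) := by
    have := gG_meas
    unfold Function.uncurry
    fun_prop
  rw [integrable_prod_iff' hm.aestronglyMeasurable]
  constructor
  · filter_upwards [ae_restrict_mem measurableSet_Ioi] with t ht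
    have := Set.mem_Ioi.1 ht
    exact (gamma_intble (β*(1+t)) (by positivity)).const_mul (C * gG t)
  · have := (int_all.1).const_mul (|C| * 6 / β^4)
    refine IntegrableOn.congr_fun this ?_ measurableSet_Ioi
    intro t ht
    have ht := Set.mem_Ioi.1 ht
    have : ∫ p in Set.Ioi (0:ℝ), ‖(C * gG t) * (p^3 * exp (-(β * (1+t)) * p))‖
        = ∫ p in Set.Ioi (0:ℝ), (|C| * gG t) * (p^3 * exp (-(β * (1+t)) * p)) := by
      apply setIntegral_congr_fun measurableSet_Ioi
      intro p hp
      have hp := Set.mem_Ioi.1 hp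
      simp only [norm_mul, norm_eq_abs]
      rw [abs_of_nonneg (gG_nonneg t), abs_of_pos (exp_pos _), abs_of_pos (pow_pos hp 3)]
    simp only [Function.uncurry]
    rw [this, integral_const_mul, gamma_int _ (by positivity)]
    have : 1 + t ≠ 0 := by positivity
    field_simp

/-- The identity `⟨f⟩_β = (β²/2)·⟨h⟩_β`: the canonical average of `H(a, p)`,
the second moment of the energy transfer rate (stripped of the geometric
factor), equals `2/(β²·√(2πβ))`. -/
theorem stmt_17 (β : ℝ) (hβ : 0 < β) :
    ∫ p in Set.Ioi (0:ℝ), ∫ a in Set.Ioi (0:ℝ),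
        (β ^ ((3:ℝ)/2) / Real.sqrt (Real.pi * p)) * Real.exp (-β*(a + p)) *
          (if p < a then
              (1/(15*Real.pi)) * (8 * (a - p) ^ ((5:ℝ)/2)
                + 15 * (-((3/8) * p * (a - 2*p) * Real.sqrt (a - p))
                    + Real.sqrt p * ((3/8)*a^2 - a*p + p^2)
                        * Real.arcsin (Real.sqrt (p/a))))
            else (1/2) * Real.sqrt p * ((3/8)*a^2 - a*p + p^2)) =
      2/(β^2 * Real.sqrt (2*Real.pi*β)) := by
  have h1 : ∀ p ∈ Set.Ioi (0:ℝ), (∫ a in Set.Ioi (0:ℝ),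
        (β ^ ((3:ℝ)/2) / Real.sqrt (Real.pi * p)) * Real.exp (-β*(a + p)) *
          (if p < a then
              (1/(15*Real.pi)) * (8 * (a - p) ^ ((5:ℝ)/2)
                + 15 * (-((3/8) * p * (a - 2*p) * Real.sqrt (a - p))
                    + Real.sqrt p * ((3/8)*a^2 - a*p + p^2)
                        * Real.arcsin (Real.sqrt (p/a))))
            else (1/2) * Real.sqrt p * ((3/8)*a^2 - a*p + p^2))) =
      ∫ t in Set.Ioi (0:ℝ), (β ^ ((3:ℝ)/2) / √π * gG t) * (p^3 * exp (-(β * (1+t)) * p)) := by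
    intro p hp
    have hp := Set.mem_Ioi.1 hp
    have := integral_comp_mul_left_Ioi' (fun a => (β ^ ((3:ℝ)/2) / Real.sqrt (Real.pi * p)) * Real.exp (-β*(a + p)) *
          (if p < a then
              (1/(15*Real.pi)) * (8 * (a - p) ^ ((5:ℝ)/2)
                + 15 * (-((3/8) * p * (a - 2*p) * Real.sqrt (a - p))
                    + Real.sqrt p * ((3/8)*a^2 - a*p + p^2)
                        * Real.arcsin (Real.sqrt (p/a))))
            else (1/2) * Real.sqrt p * ((3/8)*a^2 - a*p + p^2))) 0 hp
    rw [mul_zero] at this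
    rw [← this, smul_eq_mul, ← integral_const_mul]
    congr 1
    funext t
    exact scale β p t hp
  rw [setIntegral_congr_fun measurableSet_Ioi h1, integral_integral_swap (swap_intble β hβ _)]
  have h2 : ∀ t ∈ Set.Ioi (0:ℝ), (∫ p in Set.Ioi (0:ℝ),
      (β ^ ((3:ℝ)/2) / √π * gG t) * (p^3 * exp (-(β * (1+t)) * p))) =
      (β ^ ((3:ℝ)/2) / √π * 6 / β^4) * (gG t / (1+t)^4) := by
    intro t ht
    have ht := Set.mem_Ioi.1 ht
    rw [integral_const_mul, gamma_int _ (by positivity)]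
    have : 1 + t ≠ 0 := by positivity
    field_simp
  rw [setIntegral_congr_fun measurableSet_Ioi h2, integral_const_mul, int_all.2]
  have hb : β ^ ((3:ℝ)/2) = β * √β := by
    rw [show (3:ℝ)/2 = 1 + 1/2 by norm_num, rpow_add hβ, rpow_one, sqrt_eq_rpow]
  rw [hb, sqrt_mul (by positivity), sqrt_mul (by norm_num)]
  have q1 : √β^2 = β := sq_sqrt hβ.le
  have q2 : √2^2 = (2:ℝ) := sq_sqrt (by norm_num)
  have : 0 < √β := sqrt_pos.2 hβ
  have : 0 < √π := sqrt_pos.2 pi_pos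
  field_simp
  rw [q1, q2]
  try ring
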